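/- Let B ≥ 1 be an integer. Then sup over θ ∈ S_B, over k ≥ 1, and over integers N with q_k ≤ N < q_k + q_{k−1} (where p_k/q_k are the convergents of θ) of N·H(θ, N) equals 1 + ((B+1)·√(B²+4B) + B² − B)/(2B² + 2B + 1). -/

import Mathlib

/-- The points `0, {θ}, {2θ}, …, {Nθ}, 1` used in the three-gap theorem. -/
def gapPoints (θ : ℝ) (N : ℕ) : Set ℝ :=
  insert 1 {x : ℝ | ∃ k : ℕ, k ≤ N ∧ x = Int.fract (k * θ)}

/-- The gap set `G(θ, N)`: the set of differences between consecutive points among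
`0, {θ}, {2θ}, …, {Nθ}, 1` sorted in ascending order. -/
def gapSet (θ : ℝ) (N : ℕ) : Set ℝ :=
  {d : ℝ | ∃ a ∈ gapPoints θ N, ∃ b ∈ gapPoints θ N,
    a < b ∧ (∀ c ∈ gapPoints θ N, ¬(a < c ∧ c < b)) ∧ d = b - a}

/-- `H(θ, N)`, the largest gap in the gap set `G(θ, N)`. -/
noncomputable def maxGap (θ : ℝ) (N : ℕ) : ℝ := sSup (gapSet θ N)

/-- `θ` has all partial quotients `a_i` (for `i ≥ 1`) of its simple continued fraction
expansion bounded by `B`.  (Index `i` of `partDens` corresponds to `a_{i+1}`.) -/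
def PartQuotBounded (θ : ℝ) (B : ℕ) : Prop :=
  ∀ i : ℕ, ∀ a ∈ ((GenContFract.of θ).partDens.get? i), a ≤ (B : ℝ)

/-- `S_B`: the set of irrational numbers in `(0,1)` with partial quotients bounded by `B`. -/
def SB (B : ℕ) : Set ℝ :=
  {θ : ℝ | Irrational θ ∧ θ ∈ Set.Ioo (0 : ℝ) 1 ∧ PartQuotBounded θ B}

/-- The Gauss map `x ↦ {1/x}`. -/
noncomputable def gaussMap (x : ℝ) : ℝ := Int.fract x⁻¹

/-- The `n`-th complete remainder `[0; a_{n+1}, a_{n+2}, …]` of `θ = [0; a_1, a_2, …]`. -/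
noncomputable def cfTail (θ : ℝ) (n : ℕ) : ℝ := gaussMap^[n] θ

/-- The partial quotient `a_{n+1}` of `θ ∈ (0, 1)`. -/
noncomputable def cfDigit (θ : ℝ) (n : ℕ) : ℕ := ⌊(cfTail θ n)⁻¹⌋₊

/-- The convergent denominators, shifted by one: `cfDen θ (k + 1) = q_k` and `cfDen θ 0 = 0`. -/
noncomputable def cfDen (θ : ℝ) : ℕ → ℕ
  | 0 => 0
  | 1 => 1
  | n + 2 => cfDigit θ n * cfDen θ (n + 1) + cfDen θ n

/-- The convergent numerators, shifted by one: `cfNum θ (k + 1) = p_k` and `cfNum θ 0 = 1`. -/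
noncomputable def cfNum (θ : ℝ) : ℕ → ℕ
  | 0 => 1
  | 1 => 0
  | n + 2 => cfDigit θ n * cfNum θ (n + 1) + cfNum θ n

/-- The approximation errors, shifted by one: `cfErr θ (k + 1) = |q_k θ - p_k|`. -/
noncomputable def cfErr (θ : ℝ) : ℕ → ℝ
  | 0 => 1
  | n + 1 => cfErr θ n * cfTail θ n

section Gaps

variable {θ α β : ℝ} {N u v : ℕ} {P R : ℤ}

lemma exists_gapPoint_of_shift {i j : ℕ} {δ : ℝ} {z : ℤ} (hi : i ≤ N) (hδ : 0 < δ)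
    (h : (i : ℝ) * θ = j * θ + δ + z) :
    ∃ c ∈ gapPoints θ N, Int.fract (j * θ) < c ∧ c ≤ Int.fract (j * θ) + δ := by
  rcases lt_or_ge (Int.fract (j * θ) + δ) 1 with h1 | h1
  · refine ⟨Int.fract (j * θ) + δ, Or.inr ⟨i, hi, ?_⟩, by linarith, le_rfl⟩
    refine (Int.fract_eq_iff.2 ⟨by linarith [Int.fract_nonneg (j * θ)], h1,
      ⌊(j : ℝ) * θ⌋ + z, ?_⟩).symm
    push_cast
    linarith [Int.floor_add_fract ((j : ℝ) * θ)]
  · exact ⟨1, Or.inl rfl, Int.fract_lt_one _, h1⟩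

lemma le_one_of_mem_gapPoints {c : ℝ} (hc : c ∈ gapPoints θ N) : c ≤ 1 := by
  rcases hc with rfl | ⟨i, -, rfl⟩
  · exact le_rfl
  · exact (Int.fract_lt_one _).le

lemma le_add_of_mem_gapSet (hu : (u : ℝ) * θ = P + α) (hv : (v : ℝ) * θ = R - β)
    (hα : 0 < α) (hβ : 0 < β) (huN : u ≤ N) (hvN : v ≤ N) {d : ℝ} (hd : d ∈ gapSet θ N) :
    d ≤ α + β := by
  obtain ⟨a, ha, b, hb, hab, hc, rfl⟩ := hd
  rcases ha with rfl | ⟨j, hj, rfl⟩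
  · linarith [le_one_of_mem_gapPoints hb]
  have key : ∃ c ∈ gapPoints θ N, Int.fract (j * θ) < c ∧ c ≤ Int.fract (j * θ) + (α + β) := by
    by_cases h1 : j + u ≤ N
    · obtain ⟨c, hc, h, h'⟩ := exists_gapPoint_of_shift (θ := θ) (j := j) (z := P) h1 hα
        (by push_cast; linarith)
      exact ⟨c, hc, h, by linarith⟩
    by_cases h2 : v ≤ j
    · obtain ⟨c, hc, h, h'⟩ := exists_gapPoint_of_shift (θ := θ) (N := N) (i := j - v) (j := j)
        (z := -R) (by omega) hβ (by push_cast [Nat.cast_sub h2]; linarith)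
      exact ⟨c, hc, h, by linarith⟩
    · exact exists_gapPoint_of_shift (i := j + u - v) (z := P - R) (by omega) (by linarith)
        (by rw [Nat.cast_sub (by omega)]; push_cast; linarith)
  obtain ⟨c, hcm, h, h'⟩ := key
  have := hc c hcm
  by_contra! hlt
  exact this ⟨h, by linarith⟩

lemma not_mem_Ioo_of_det (hu : (u : ℝ) * θ = P + α) (hv : (v : ℝ) * θ = R - β)
    (hα : 0 < α) (hβ : 0 < β) (hdet : u * β + v * α = 1) {d p : ℤ}
    (hdv : -(v : ℤ) < d) (hdu : d < u) (h0 : 0 < d * θ - p) : α + β ≤ d * θ - p := by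
  have hdetZ : (u : ℤ) * R - v * P = 1 := by
    have : (u : ℝ) * R - v * P = 1 := by linear_combination hdet + (v : ℝ) * hu - u * hv
    exact_mod_cast this
  obtain ⟨s, hs⟩ : ∃ s : ℤ, s = d * R - v * p := ⟨_, rfl⟩
  obtain ⟨t, ht⟩ : ∃ t : ℤ, t = u * p - d * P := ⟨_, rfl⟩
  have hd : d = s * u + t * v := by rw [hs, ht]; linear_combination -d * hdetZ
  have hp : p = s * P + t * R := by rw [hs, ht]; linear_combination -p * hdetZ
  have hval : (d : ℝ) * θ - p = s * α - t * β := by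
    rw [hd, hp]; push_cast; linear_combination (s : ℝ) * hu + t * hv
  rw [hval] at h0 ⊢
  have hu0 : (0 : ℤ) ≤ u := by positivity
  have hv0 : (0 : ℤ) ≤ v := by positivity
  rcases le_or_gt s 0 with hs0 | hs0 <;> rcases le_or_gt 0 t with ht0 | ht0
  · have h1 : (s : ℝ) ≤ 0 := by exact_mod_cast hs0
    have h2 : (0 : ℝ) ≤ t := by exact_mod_cast ht0
    nlinarith
  · have : t ≤ -1 := by omega
    nlinarith
  · have : 1 ≤ s := by omega
    nlinarith
  · have h1 : (1 : ℝ) ≤ s := by exact_mod_cast hs0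
    have h2 : (t : ℝ) ≤ -1 := by exact_mod_cast (by omega : t ≤ -1)
    nlinarith

lemma add_mem_gapSet (hu : (u : ℝ) * θ = P + α) (hv : (v : ℝ) * θ = R - β)
    (hα : 0 < α) (hβ : 0 < β) (hdet : u * β + v * α = 1) (hu1 : 1 ≤ u) (hv1 : 1 ≤ v)
    (huN : u ≤ N) (hvN : v ≤ N) (hN : N + 2 ≤ u + v) : α + β ∈ gapSet θ N := by
  set a := Int.fract (((v - 1 : ℕ) : ℝ) * θ) with ha
  have hfl := Int.floor_add_fract (((v - 1 : ℕ) : ℝ) * θ)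
  rw [← ha] at hfl
  have hcast : ((v - 1 : ℕ) : ℝ) = v - 1 := by push_cast [Nat.cast_sub hv1]; ring
  have hcastu : ((u - 1 : ℕ) : ℝ) = u - 1 := by push_cast [Nat.cast_sub hu1]; ring
  have hempty : ∀ c ∈ gapPoints θ N, a < c → a + (α + β) ≤ c := by
    intro c hc hac
    obtain ⟨i, hi, w, hw⟩ : ∃ i : ℕ, i ≤ N ∧ ∃ w : ℤ, c = i * θ - w := by
      rcases hc with rfl | ⟨i, hi, rfl⟩
      · exact ⟨0, by omega, -1, by simp⟩
      · exact ⟨i, hi, ⌊(i : ℝ) * θ⌋, rfl⟩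
    have hdist : ((i - (v - 1) : ℤ) : ℝ) * θ - (w - ⌊((v - 1 : ℕ) : ℝ) * θ⌋ : ℤ) = c - a := by
      rw [hcast] at hfl ⊢
      push_cast
      linarith
    have := not_mem_Ioo_of_det (d := i - (v - 1)) (p := w - ⌊((v - 1 : ℕ) : ℝ) * θ⌋)
      hu hv hα hβ hdet (by omega) (by omega) (by rw [hdist]; linarith)
    rw [hdist] at this
    linarith
  have hle : a + (α + β) ≤ 1 := hempty 1 (Or.inl rfl) (Int.fract_lt_one _)
  refine ⟨a, Or.inr ⟨v - 1, by omega, rfl⟩, a + (α + β), ?_, by linarith, ?_, by ring⟩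
  · obtain ⟨c, hc, h, h'⟩ := exists_gapPoint_of_shift (θ := θ) (N := N) (i := u - 1) (j := v - 1)
      (δ := α + β) (z := P - R) (by omega) (by linarith)
      (by rw [hcast, hcastu]; push_cast; linarith)
    rwa [← le_antisymm h' (hempty c hc h)]
  · rintro c hc ⟨h, h'⟩
    linarith [hempty c hc h]

end Gaps

section Recurrences

variable {θ : ℝ}

lemma gaussMap_mem {x : ℝ} (hx : Irrational x) :
    Irrational (gaussMap x) ∧ gaussMap x ∈ Set.Ioo (0 : ℝ) 1 := by
  have h : Irrational (gaussMap x) := by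
    unfold gaussMap
    rw [Int.fract]
    exact hx.inv.sub_intCast _
  exact ⟨h, lt_of_le_of_ne (Int.fract_nonneg _) (h.ne_zero).symm, Int.fract_lt_one _⟩

lemma cfTail_succ (θ : ℝ) (n : ℕ) : cfTail θ (n + 1) = gaussMap (cfTail θ n) :=
  Function.iterate_succ_apply' _ _ _

lemma cfTail_mem (hθ : Irrational θ) (h01 : θ ∈ Set.Ioo (0 : ℝ) 1) (n : ℕ) :
    Irrational (cfTail θ n) ∧ cfTail θ n ∈ Set.Ioo (0 : ℝ) 1 := by
  induction n with
  | zero => exact ⟨hθ, h01⟩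
  | succ n ih => rw [cfTail_succ]; exact gaussMap_mem ih.1

lemma one_le_cfDigit (hθ : Irrational θ) (h01 : θ ∈ Set.Ioo (0 : ℝ) 1) (n : ℕ) :
    1 ≤ cfDigit θ n := by
  obtain ⟨-, h0, h1⟩ := cfTail_mem hθ h01 n
  exact Nat.le_floor (by simpa using (one_le_inv₀ h0).2 h1.le)

lemma cfTail_mul (hθ : Irrational θ) (h01 : θ ∈ Set.Ioo (0 : ℝ) 1) (n : ℕ) :
    cfTail θ n * (cfDigit θ n + cfTail θ (n + 1)) = 1 := by
  obtain ⟨-, h0, h1⟩ := cfTail_mem hθ h01 n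
  have h : (cfDigit θ n : ℝ) + cfTail θ (n + 1) = (cfTail θ n)⁻¹ := by
    rw [cfTail_succ, gaussMap, cfDigit, natCast_floor_eq_intCast_floor (inv_pos.2 h0).le]
    exact Int.floor_add_fract _
  rw [h, mul_inv_cancel₀ h0.ne']

lemma cfErr_pos (hθ : Irrational θ) (h01 : θ ∈ Set.Ioo (0 : ℝ) 1) (n : ℕ) : 0 < cfErr θ n := by
  induction n with
  | zero => exact one_pos
  | succ n ih => exact mul_pos ih (cfTail_mem hθ h01 n).2.1

lemma cfErr_add_two (hθ : Irrational θ) (h01 : θ ∈ Set.Ioo (0 : ℝ) 1) (n : ℕ) :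
    cfErr θ (n + 2) = cfErr θ n - cfDigit θ n * cfErr θ (n + 1) := by
  simp only [cfErr]
  linear_combination cfErr θ n * cfTail_mul hθ h01 n

lemma cfDen_mul_sub (hθ : Irrational θ) (h01 : θ ∈ Set.Ioo (0 : ℝ) 1) (n : ℕ) :
    cfDen θ n * θ - cfNum θ n = (-1) ^ (n + 1) * cfErr θ n := by
  induction n using Nat.twoStepInduction with
  | zero => simp [cfDen, cfNum, cfErr]
  | one => simp [cfDen, cfNum, cfErr, cfTail]
  | more n ih1 ih2 =>
    rw [cfErr_add_two hθ h01, cfDen, cfNum]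
    push_cast
    linear_combination ih1 + (cfDigit θ n : ℝ) * ih2

lemma cfDen_mul_cfErr (hθ : Irrational θ) (h01 : θ ∈ Set.Ioo (0 : ℝ) 1) (n : ℕ) :
    cfDen θ (n + 1) * cfErr θ n + cfDen θ n * cfErr θ (n + 1) = 1 := by
  induction n with
  | zero => simp [cfDen, cfErr]
  | succ n ih =>
    rw [cfErr_add_two hθ h01, cfDen]
    push_cast
    linear_combination ih

lemma one_le_cfDen_succ (hθ : Irrational θ) (h01 : θ ∈ Set.Ioo (0 : ℝ) 1) (n : ℕ) :
    1 ≤ cfDen θ (n + 1) := by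
  induction n with
  | zero => exact le_rfl
  | succ n ih =>
    have := Nat.mul_le_mul (one_le_cfDigit hθ h01 n) ih
    rw [cfDen]
    omega

lemma cfDen_add_le (hθ : Irrational θ) (h01 : θ ∈ Set.Ioo (0 : ℝ) 1) (n : ℕ) :
    cfDen θ (n + 1) + cfDen θ n ≤ cfDen θ (n + 1 + 1) := by
  have := Nat.mul_le_mul_right (cfDen θ (n + 1)) (one_le_cfDigit hθ h01 n)
  rw [cfDen]
  omega

lemma le_cfDen_succ (hθ : Irrational θ) (h01 : θ ∈ Set.Ioo (0 : ℝ) 1) (n : ℕ) :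
    n ≤ cfDen θ (n + 1) := by
  induction n with
  | zero => exact Nat.zero_le _
  | succ n ih =>
    have h := cfDen_add_le hθ h01 n
    rcases n with _ | n
    · exact one_le_cfDen_succ hθ h01 1
    · have := one_le_cfDen_succ hθ h01 n
      omega

end Recurrences

section MathlibBridge

open GenContFract

variable {θ : ℝ}

lemma stream_eq_some (hθ : Irrational θ) (h01 : θ ∈ Set.Ioo (0 : ℝ) 1) (n : ℕ) :
    ∃ p, IntFractPair.stream θ n = some p ∧ p.fr = cfTail θ n := by
  induction n with
  | zero => exact ⟨_, rfl, Int.fract_eq_self.2 ⟨h01.1.le, h01.2⟩⟩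
  | succ n ih =>
    obtain ⟨p, hp, hfr⟩ := ih
    refine ⟨_, IntFractPair.stream_succ_of_some hp ?_, ?_⟩
    · rw [hfr]; exact (cfTail_mem hθ h01 n).1.ne_zero
    · rw [hfr, cfTail_succ]; rfl

lemma s_get?_eq (hθ : Irrational θ) (h01 : θ ∈ Set.Ioo (0 : ℝ) 1) (n : ℕ) :
    (GenContFract.of θ).s.get? n = some ⟨1, (cfDigit θ n : ℝ)⟩ := by
  obtain ⟨p, hp, hfr⟩ := stream_eq_some hθ h01 n
  have h0 := (cfTail_mem hθ h01 n).2.1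
  have := get?_of_eq_some_of_succ_get?_intFractPair_stream
    (IntFractPair.stream_succ_of_some hp (by rw [hfr]; exact h0.ne'))
  rw [this, hfr, cfDigit, natCast_floor_eq_intCast_floor (inv_pos.2 h0).le]
  rfl

lemma dens_eq_cfDen (hθ : Irrational θ) (h01 : θ ∈ Set.Ioo (0 : ℝ) 1) (n : ℕ) :
    (GenContFract.of θ).dens n = cfDen θ (n + 1) := by
  induction n using Nat.twoStepInduction with
  | zero => simp [cfDen]
  | one => rw [first_den_eq (s_get?_eq hθ h01 0)]; simp [cfDen]
  | more n ih1 ih2 =>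
    rw [dens_recurrence (s_get?_eq hθ h01 (n + 1)) ih1 ih2,
      show cfDen θ (n + 2 + 1) = cfDigit θ (n + 1) * cfDen θ (n + 1 + 1) + cfDen θ (n + 1) from rfl]
    push_cast
    ring

lemma partQuotBounded_iff (hθ : Irrational θ) (h01 : θ ∈ Set.Ioo (0 : ℝ) 1) (B : ℕ) :
    PartQuotBounded θ B ↔ ∀ n, cfDigit θ n ≤ B := by
  refine forall_congr' fun n => ?_
  rw [partDen_eq_s_b (s_get?_eq hθ h01 n)]
  simp

end MathlibBridge

lemma mem_SB_iff {θ : ℝ} {B : ℕ} :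
    θ ∈ SB B ↔ Irrational θ ∧ θ ∈ Set.Ioo (0 : ℝ) 1 ∧ ∀ n, cfDigit θ n ≤ B :=
  and_congr_right fun hθ => and_congr_right fun h01 => partQuotBounded_iff hθ h01 B

section MaxGap

variable {θ : ℝ} {N k : ℕ}

/-- The two convergent denominators `q_k`, `q_{k-1}`, ordered by the sign of the error. -/
lemma exists_signed_denominators (hθ : Irrational θ) (h01 : θ ∈ Set.Ioo (0 : ℝ) 1) (k : ℕ)
    (C : ℕ → ℕ → ℝ → ℝ → Prop)
    (hC : ∀ (u v : ℕ) (P R : ℤ) (α β : ℝ), (u : ℝ) * θ = P + α → (v : ℝ) * θ = R - β →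
      0 < α → 0 < β → u * β + v * α = 1 → C u v α β)
    (hsymm : ∀ u v α β, C u v α β → C v u β α) :
    C (cfDen θ (k + 1)) (cfDen θ k) (cfErr θ (k + 1)) (cfErr θ k) := by
  have h1 := cfDen_mul_sub hθ h01 k
  have h2 := cfDen_mul_sub hθ h01 (k + 1)
  have hdet := cfDen_mul_cfErr hθ h01 k
  have e1 := cfErr_pos hθ h01 k
  have e2 := cfErr_pos hθ h01 (k + 1)
  rcases Nat.even_or_odd k with hk | hk
  · rw [hk.add_one.neg_one_pow] at h1
    rw [hk.add_one.add_one.neg_one_pow] at h2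
    exact hC _ _ (cfNum θ (k + 1)) (cfNum θ k) _ _ (by push_cast; linarith)
      (by push_cast; linarith) e2 e1 (by linarith)
  · rw [hk.add_one.neg_one_pow] at h1
    rw [hk.add_one.add_one.neg_one_pow] at h2
    exact hsymm _ _ _ _ (hC _ _ (cfNum θ k) (cfNum θ (k + 1)) _ _ (by push_cast; linarith)
      (by push_cast; linarith) e1 e2 (by linarith))

lemma cfDen_le_succ (hθ : Irrational θ) (h01 : θ ∈ Set.Ioo (0 : ℝ) 1) (k : ℕ) :
    cfDen θ k ≤ cfDen θ (k + 1) := by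
  rcases k with _ | k
  · exact Nat.zero_le _
  · have := cfDen_add_le hθ h01 k
    omega

lemma le_cfErr_add_of_mem_gapSet (hθ : Irrational θ) (h01 : θ ∈ Set.Ioo (0 : ℝ) 1)
    (hN : cfDen θ (k + 1) ≤ N) {d : ℝ} (hd : d ∈ gapSet θ N) :
    d ≤ cfErr θ (k + 1) + cfErr θ k :=
  exists_signed_denominators hθ h01 k
    (fun u v α β => u ≤ N → v ≤ N → d ≤ α + β)
    (fun _ _ _ _ _ _ hu hv hα hβ _ huN hvN => le_add_of_mem_gapSet hu hv hα hβ huN hvN hd)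
    (fun _ _ α β h hv hu => (h hu hv).trans_eq (add_comm α β)) hN ((cfDen_le_succ hθ h01 k).trans hN)

lemma maxGap_le (hθ : Irrational θ) (h01 : θ ∈ Set.Ioo (0 : ℝ) 1)
    (hN : cfDen θ (k + 1) ≤ N) : maxGap θ N ≤ cfErr θ (k + 1) + cfErr θ k :=
  Real.sSup_le (fun _ hd => le_cfErr_add_of_mem_gapSet hθ h01 hN hd)
    (add_pos (cfErr_pos hθ h01 _) (cfErr_pos hθ h01 _)).le

lemma le_maxGap (hθ : Irrational θ) (h01 : θ ∈ Set.Ioo (0 : ℝ) 1) (hk : 1 ≤ k)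
    (hN : cfDen θ (k + 1) ≤ N) (hN' : N + 2 ≤ cfDen θ (k + 1) + cfDen θ k) :
    cfErr θ (k + 1) + cfErr θ k ≤ maxGap θ N := by
  refine le_csSup ⟨_, fun _ hd => le_cfErr_add_of_mem_gapSet hθ h01 hN hd⟩ ?_
  have hk1 : 1 ≤ cfDen θ k := by
    obtain ⟨j, rfl⟩ := Nat.exists_eq_add_of_le' hk
    exact one_le_cfDen_succ hθ h01 j
  have hle := cfDen_le_succ hθ h01 k
  exact exists_signed_denominators hθ h01 k
    (fun u v α β => 1 ≤ u → 1 ≤ v → u ≤ N → v ≤ N → N + 2 ≤ u + v → α + β ∈ gapSet θ N)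
    (fun _ _ _ _ _ _ hu hv hα hβ hdet hu1 hv1 huN hvN hN =>
      add_mem_gapSet hu hv hα hβ hdet hu1 hv1 huN hvN hN)
    (fun _ _ _ _ h hv1 hu1 hvN huN hN => by
      rw [add_comm]; exact h hu1 hv1 huN hvN (by omega))
    (one_le_cfDen_succ hθ h01 k) hk1 hN (hle.trans hN) hN'

end MaxGap

section Bounds

variable {θ : ℝ} {B : ℕ}

lemma cfTail_le_of_mem_SB (hθ : θ ∈ SB B) {M : ℝ} (hM0 : 0 < M)
    (hM : M ^ 2 + B * M = B) (k : ℕ) : cfTail θ k ≤ M := by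
  obtain ⟨hi, h01, hdig⟩ := mem_SB_iff.1 hθ
  have hmem := fun n => (cfTail_mem hi h01 n).2
  have hbdd : BddAbove (Set.range (cfTail θ)) := ⟨1, by rintro _ ⟨n, rfl⟩; exact (hmem n).2.le⟩
  set Y := ⨆ n, cfTail θ n with hY
  have hle : ∀ n, cfTail θ n ≤ Y := le_ciSup hbdd
  have hY0 : 0 < Y := (hmem 0).1.trans_le (hle 0)
  have hB0 : (0 : ℝ) ≤ B := Nat.cast_nonneg B
  have hstep : Y ≤ (B + Y) / (B + Y + 1) := by
    refine ciSup_le fun n => ?_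
    rw [le_div_iff₀ (by positivity)]
    have h1 := cfTail_mul hi h01 n
    have h2 := cfTail_mul hi h01 (n + 1)
    have hd1 : (1 : ℝ) ≤ cfDigit θ n := by exact_mod_cast one_le_cfDigit hi h01 n
    have hd2 : (cfDigit θ (n + 1) : ℝ) ≤ B := by exact_mod_cast hdig (n + 1)
    have h3 := hle (n + 1 + 1)
    obtain ⟨hx, -⟩ := hmem n
    obtain ⟨hx', -⟩ := hmem (n + 1)
    have h4 : cfTail θ n * (1 + cfTail θ (n + 1)) ≤ 1 := by nlinarith
    have h5 : 1 ≤ cfTail θ (n + 1) * (B + Y) := by nlinarith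
    nlinarith [mul_le_mul_of_nonneg_right h4 (by positivity : 0 ≤ (B : ℝ) + Y),
      mul_le_mul_of_nonneg_left h5 hx.le]
  rw [le_div_iff₀ (by positivity)] at hstep
  refine (hle k).trans ?_
  by_contra! hlt
  nlinarith

lemma cfDen_sub_le (hθ : θ ∈ SB B) {M m : ℝ} (hM0 : 0 < M) (hm0 : 0 < m)
    (hMm : M = B * m) (hm : 1 - M = M * m) (n : ℕ) :
    cfDen θ n - M * cfDen θ (n + 1) ≤ 1 ∧ m * cfDen θ (n + 1) - cfDen θ n ≤ 1 := by
  obtain ⟨hi, h01, hdig⟩ := mem_SB_iff.1 hθ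
  have hM1 : M < 1 := by nlinarith
  induction n with
  | zero =>
    have hB1 : (1 : ℝ) ≤ B := by
      exact_mod_cast (one_le_cfDigit hi h01 0).trans (hdig 0)
    simp only [cfDen]; push_cast; constructor <;> nlinarith
  | succ n ih =>
    obtain ⟨ihU, ihL⟩ := ih
    have hd1 : (1 : ℝ) ≤ cfDigit θ n := by exact_mod_cast one_le_cfDigit hi h01 n
    have hd2 : (cfDigit θ n : ℝ) ≤ B := by exact_mod_cast hdig n
    have hB1 : (1 : ℝ) ≤ B := hd1.trans hd2
    have hm1 : m ≤ 1 := by nlinarith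
    have hq : (0 : ℝ) ≤ cfDen θ (n + 1) := Nat.cast_nonneg _
    rw [show cfDen θ (n + 1 + 1) = cfDigit θ n * cfDen θ (n + 1) + cfDen θ n from rfl]
    push_cast
    constructor
    · have := mul_le_mul_of_nonneg_right hd1 (mul_nonneg hM0.le hq)
      have h2 := mul_le_mul_of_nonneg_left ihL hM0.le
      have h3 : (1 - M) * cfDen θ (n + 1) = M * m * cfDen θ (n + 1) := by rw [hm]
      linarith
    · have := mul_le_mul_of_nonneg_right hd2 (mul_nonneg hm0.le hq)
      have h2 := mul_le_mul_of_nonneg_left ihU hm0.le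
      have h3 : (B * m - 1) * cfDen θ (n + 1) = (M - 1) * cfDen θ (n + 1) := by rw [hMm]
      have h4 : (1 - M) * cfDen θ (n + 1) = M * m * cfDen θ (n + 1) := by rw [hm]
      linarith

lemma mul_maxGap_le (hθ : θ ∈ SB B) {M m : ℝ} (hM0 : 0 < M) (hm0 : 0 < m)
    (hMm : M = B * m) (hm : 1 - M = M * m) {N k : ℕ} (hk : 1 ≤ k)
    (hN : cfDen θ (k + 1) ≤ N) (hN' : N < cfDen θ (k + 1) + cfDen θ k) :
    N * maxGap θ N ≤ (1 + M) ^ 2 / (1 + M ^ 2) := by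
  obtain ⟨hi, h01, -⟩ := mem_SB_iff.1 hθ
  have hM1 : M < 1 := by nlinarith
  have hgap := maxGap_le hi h01 hN
  have hdet := cfDen_mul_cfErr hi h01 k
  have hy := cfTail_le_of_mem_SB hθ hM0 (by rw [hMm] at hm ⊢; linear_combination -(B : ℝ) * hm) k
  have hy0 := (cfTail_mem hi h01 k).2.1
  have hE := cfErr_pos hi h01 k
  have hq := (cfDen_sub_le hθ hM0 hm0 hMm hm k).1
  have hq1 : (1 : ℝ) ≤ cfDen θ k := by
    obtain ⟨j, rfl⟩ := Nat.exists_eq_add_of_le' hk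
    exact_mod_cast one_le_cfDen_succ hi h01 j
  have hNr : (N : ℝ) ≤ cfDen θ (k + 1) + (cfDen θ k - 1) := by
    have : (N : ℝ) + 1 ≤ cfDen θ (k + 1) + cfDen θ k := by exact_mod_cast hN'
    linarith
  have hQ : (0 : ℝ) ≤ cfDen θ (k + 1) := Nat.cast_nonneg _
  simp only [cfErr] at hgap hdet
  generalize (cfDen θ (k + 1) : ℝ) = q at *
  generalize (cfDen θ k : ℝ) = r at *
  generalize cfTail θ k = y at *
  generalize cfErr θ k = e at *
  have h1 : N * maxGap θ N ≤ (q + (r - 1)) * (e * y + e) :=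
    mul_le_mul hNr hgap (Real.sSup_nonneg fun d hd => by
      obtain ⟨a, -, b, -, hab, -, rfl⟩ := hd
      linarith) (by linarith)
  refine h1.trans ?_
  rw [le_div_iff₀ (by positivity)]
  have key : (q + (r - 1)) * (1 + y) * (1 + M ^ 2) ≤ (1 + M) ^ 2 * (q + (r - 1) * y) := by
    have a1 : 0 ≤ (M * q - (r - 1)) * (1 + M ^ 2 - 2 * M * y) :=
      mul_nonneg (by linarith) (by nlinarith)
    have a2 : 0 ≤ q * ((M - y) * (1 - M ^ 2)) :=
      mul_nonneg hQ (mul_nonneg (by linarith) (by nlinarith))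
    nlinarith
  have h2 : e * (q + (r - 1) * y) ≤ 1 := by nlinarith [mul_pos hE hy0]
  calc (q + (r - 1)) * (e * y + e) * (1 + M ^ 2)
      = e * ((q + (r - 1)) * (1 + y) * (1 + M ^ 2)) := by ring
    _ ≤ e * ((1 + M) ^ 2 * (q + (r - 1) * y)) := by gcongr
    _ = (1 + M) ^ 2 * (e * (q + (r - 1) * y)) := by ring
    _ ≤ (1 + M) ^ 2 * 1 := by gcongr
    _ = (1 + M) ^ 2 := mul_one _

end Bounds

section Extremal

variable {θ : ℝ} {B : ℕ}

lemma inv_natCast_add {a : ℕ} {z : ℝ} (hz : z ∈ Set.Ioo (0 : ℝ) 1) :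
    gaussMap (a + z)⁻¹ = z ∧ ⌊((a + z : ℝ)⁻¹)⁻¹⌋₊ = a := by
  have h : ⌊z⌋₊ = 0 := Nat.floor_eq_zero.2 hz.2
  refine ⟨?_, ?_⟩
  · rw [gaussMap, inv_inv, Int.fract_natCast_add, Int.fract_eq_self.2 ⟨hz.1.le, hz.2⟩]
  · rw [inv_inv, add_comm, Nat.floor_add_natCast hz.1.le, h, zero_add]

lemma inv_natCast_add_mem_Ioo {a : ℕ} {z : ℝ} (ha : 1 ≤ a) (hz : z ∈ Set.Ioo (0 : ℝ) 1) :
    (a + z)⁻¹ ∈ Set.Ioo (0 : ℝ) 1 := by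
  have ha' : (1 : ℝ) ≤ a := by exact_mod_cast ha
  exact ⟨inv_pos.2 (by linarith [hz.1]), inv_lt_one_of_one_lt₀ (by linarith [hz.1])⟩

lemma inv_natCast_add_mem_SB {a : ℕ} {z : ℝ} (ha : 1 ≤ a) (haB : a ≤ B) (hz : z ∈ SB B) :
    (a + z)⁻¹ ∈ SB B := by
  obtain ⟨hi, h01, hd⟩ := mem_SB_iff.1 hz
  obtain ⟨hg, hf⟩ := inv_natCast_add (a := a) h01
  refine mem_SB_iff.2 ⟨(hi.natCast_add a).inv, inv_natCast_add_mem_Ioo ha h01,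
    fun n => ?_⟩
  rcases n with _ | n
  · exact hf.le.trans haB
  · have : cfTail ((a : ℝ) + z)⁻¹ (n + 1) = cfTail z n := by
      rw [cfTail, Function.iterate_succ_apply, hg, cfTail]
    rw [cfDigit, this]
    exact hd n

/-- The map `[0; x] ↦ [0; 1, B, x]`. -/
noncomputable def prependOneB (B : ℕ) (z : ℝ) : ℝ := ((1 : ℕ) + ((B : ℝ) + z)⁻¹)⁻¹

lemma prependOneB_mem_SB (hB : 1 ≤ B) {z : ℝ} (hz : z ∈ SB B) : prependOneB B z ∈ SB B :=
  inv_natCast_add_mem_SB le_rfl hB (inv_natCast_add_mem_SB hB le_rfl hz)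

lemma iterate_prependOneB_mem_SB (hB : 1 ≤ B) {z : ℝ} (hz : z ∈ SB B) (n : ℕ) :
    (prependOneB B)^[n] z ∈ SB B := by
  induction n with
  | zero => exact hz
  | succ n ih => rw [Function.iterate_succ_apply']; exact prependOneB_mem_SB hB ih

lemma cfTail_prependOneB (hB : 1 ≤ B) {z : ℝ} (hz : z ∈ Set.Ioo (0 : ℝ) 1) :
    cfTail (prependOneB B z) 1 = ((B : ℝ) + z)⁻¹ ∧ cfTail (prependOneB B z) 2 = z ∧
      cfDigit (prependOneB B z) 0 = 1 ∧ cfDigit (prependOneB B z) 1 = B := by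
  have h1 := inv_natCast_add (a := B) hz
  have h2 := inv_natCast_add (a := 1) (inv_natCast_add_mem_Ioo hB hz)
  have e1 : cfTail (prependOneB B z) 1 = ((B : ℝ) + z)⁻¹ := h2.1
  exact ⟨e1, by rw [cfTail_succ, e1, h1.1], h2.2, by rw [cfDigit, e1]; exact h1.2⟩

lemma cfTail_add (θ : ℝ) (i j : ℕ) : cfTail θ (i + j) = cfTail (cfTail θ i) j := by
  rw [add_comm, cfTail, Function.iterate_add_apply]
  rfl

lemma cfDigit_add (θ : ℝ) (i j : ℕ) : cfDigit θ (i + j) = cfDigit (cfTail θ i) j := by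
  rw [cfDigit, cfTail_add, cfDigit]

lemma cfTail_iterate_prependOneB (hB : 1 ≤ B) {z : ℝ} (hz : z ∈ SB B) (i j : ℕ) :
    cfTail ((prependOneB B)^[i + j] z) (2 * i) = (prependOneB B)^[j] z := by
  induction i generalizing j with
  | zero => simp [cfTail]
  | succ i ih =>
    rw [show 2 * (i + 1) = 2 * i + 2 by ring, cfTail_add, show i + 1 + j = i + (j + 1) by ring,
      ih, Function.iterate_succ_apply']
    exact (cfTail_prependOneB hB (iterate_prependOneB_mem_SB hB hz j).2.1).2.1

/-- If the first digits of `θ` are `1, B, 1, B, …, 1, B`, then `q_{k-1}/q_k` is close to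
`[0; B, 1, B, 1, …]`. -/
lemma abs_cfDen_sub_le {M m : ℝ} (hM0 : 0 < M) (hm0 : 0 < m) (hm1 : m ≤ 1)
    (hMm : M = B * m) (hm : 1 - M = M * m) (n : ℕ)
    (h : ∀ i < n, cfDigit θ (2 * i) = 1 ∧ cfDigit θ (2 * i + 1) = B) :
    |m * cfDen θ (2 * n + 1) - cfDen θ (2 * n)| ≤ 1 := by
  induction n with
  | zero => simpa [cfDen, abs_of_pos hm0] using hm1
  | succ n ih =>
    have ih := ih fun i hi => h i (by omega)
    obtain ⟨h1, h2⟩ := h n (by omega)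
    have e1 : (cfDen θ (2 * n + 2) : ℝ) = cfDen θ (2 * n + 1) + cfDen θ (2 * n) := by
      rw [cfDen, h1]; push_cast; ring
    have e2 : (cfDen θ (2 * n + 3) : ℝ) = B * cfDen θ (2 * n + 2) + cfDen θ (2 * n + 1) := by
      rw [show cfDen θ (2 * n + 3) = cfDigit θ (2 * n + 1) * cfDen θ (2 * n + 2)
        + cfDen θ (2 * n + 1) from rfl, h2]
      push_cast; ring
    rw [show 2 * (n + 1) + 1 = 2 * n + 3 by ring, show 2 * (n + 1) = 2 * n + 2 by ring, e2, e1]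
    have : m * (B * (cfDen θ (2 * n + 1) + cfDen θ (2 * n)) + cfDen θ (2 * n + 1))
        - (cfDen θ (2 * n + 1) + cfDen θ (2 * n))
        = m * M * (m * cfDen θ (2 * n + 1) - cfDen θ (2 * n)) := by
      linear_combination
        (-(cfDen θ (2 * n + 1) : ℝ) - cfDen θ (2 * n)) * hMm
          + (m * (cfDen θ (2 * n + 1) : ℝ) - cfDen θ (2 * n + 1) - cfDen θ (2 * n)) * hm
    rw [this, abs_mul, abs_of_pos (by positivity)]
    exact mul_le_one₀ (by linarith) (abs_nonneg _) ih

lemma mem_SB_of_sq_add_mul (hB : 1 ≤ B) {M : ℝ} (hi : Irrational M)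
    (h01 : M ∈ Set.Ioo (0 : ℝ) 1) (hM : M ^ 2 + B * M = B) : M ∈ SB B := by
  have hfix : prependOneB B M = M := by
    have hpos : (0 : ℝ) < B + M := add_pos_of_nonneg_of_pos (Nat.cast_nonneg _) h01.1
    rw [prependOneB]
    rw [inv_eq_iff_eq_inv]
    field_simp [h01.1.ne']
    push_cast
    linarith
  obtain ⟨-, h2, hd0, hd1⟩ := cfTail_prependOneB hB h01
  rw [hfix] at h2 hd0 hd1
  refine mem_SB_iff.2 ⟨hi, h01, fun n => ?_⟩
  induction n using Nat.twoStepInduction with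
  | zero => omega
  | one => omega
  | more n ih _ => rwa [add_comm, cfDigit_add, h2]

lemma sub_ten_div_le_mul_of_det {M m x y e n : ℝ} (hM0 : 0 < M) (hM1 : M < 1)
    (hm : 1 - M = M * m) (habs : |m * x - y| ≤ 1) (hn : 0 < n) (hx : n ≤ x) (hy : 0 ≤ y)
    (he0 : 0 ≤ e) (hdet : e * (x + y + x * M) = 1) :
    (1 + M) ^ 2 / (1 + M ^ 2) - 10 / n ≤ e * ((x + y + x - 2) * (1 + M)) := by
  obtain ⟨L, hL⟩ : ∃ L, L = (1 + M) ^ 2 / (1 + M ^ 2) := ⟨_, rfl⟩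
  have hL1 : L * (1 + M ^ 2) = (1 + M) ^ 2 := by rw [hL, div_mul_cancel₀ _ (by positivity)]
  have hL0 : 0 < L := by rw [hL]; positivity
  have hL2 : L ≤ 2 := by
    rw [hL, div_le_iff₀ (by positivity)]
    nlinarith [sq_nonneg (1 - M)]
  rw [← hL]
  obtain ⟨δ, hδ⟩ : ∃ δ, δ = x - M * (x + y) := ⟨_, rfl⟩
  have hδ' : |δ| ≤ 1 := by
    rw [show δ = M * (m * x - y) by rw [hδ]; linear_combination x * hm, abs_mul, abs_of_pos hM0]
    exact mul_le_one₀ hM1.le (abs_nonneg _) habs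
  obtain ⟨hδ1, hδ2⟩ := abs_le.1 hδ'
  have hmain : L * (x + y + x * M) - 10 ≤ (x + y + x - 2) * (1 + M) := by
    have hx' : x = M * (x + y) + δ := by linarith
    have h1 : L * (x + y + x * M) = (1 + M) ^ 2 * (x + y) + L * M * δ := by
      linear_combination (x + y) * hL1 + L * M * hx'
    have h2 : (x + y + x - 2) * (1 + M) = (1 + M) ^ 2 * (x + y) + (δ - 2) * (1 + M) := by
      linear_combination (1 + M) * hx'
    have h3 : L * M ≤ 2 * 1 := mul_le_mul hL2 hM1.le hM0.le zero_le_two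
    have h4 : L * M * δ ≤ L * M * 1 := mul_le_mul_of_nonneg_left hδ2 (mul_pos hL0 hM0).le
    have h5 : (2 - δ) * (1 + M) ≤ 3 * 2 :=
      mul_le_mul (by linarith) (by linarith) (by linarith) (by norm_num)
    linarith
  have he : e ≤ 1 / n := by
    rw [le_div_iff₀ hn]
    have h1 : e * n ≤ e * (x + y + x * M) :=
      mul_le_mul_of_nonneg_left (by linarith [mul_nonneg (hn.le.trans hx) hM0.le]) he0
    linarith
  calc L - 10 / n = L - 10 * (1 / n) := by ring
    _ ≤ L - 10 * e := by linarith
    _ = e * (L * (x + y + x * M) - 10) := by linear_combination -L * hdet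
    _ ≤ e * ((x + y + x - 2) * (1 + M)) := by gcongr

lemma exists_mul_maxGap_ge (hB : 1 ≤ B) {M m : ℝ} (hMS : M ∈ SB B) (hm0 : 0 < m)
    (hMm : M = B * m) (hm : 1 - M = M * m) {n : ℕ} (hn : 1 ≤ n) :
    ∃ θ ∈ SB B, ∃ k : ℕ, 1 ≤ k ∧ ∃ N : ℕ, cfDen θ (k + 1) ≤ N ∧
      N < cfDen θ (k + 1) + cfDen θ k ∧
      (1 + M) ^ 2 / (1 + M ^ 2) - 10 / n ≤ N * maxGap θ N := by
  obtain ⟨-, ⟨hM0, hM1⟩, -⟩ := mem_SB_iff.1 hMS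
  have hB1 : (1 : ℝ) ≤ B := by exact_mod_cast hB
  obtain ⟨z, hz⟩ : ∃ z : ℝ, z = ((1 : ℕ) + M)⁻¹ := ⟨_, rfl⟩
  have hzS : z ∈ SB B := hz ▸ inv_natCast_add_mem_SB le_rfl hB hMS
  obtain ⟨hz1, hz0⟩ := inv_natCast_add (a := 1) hMS.2.1
  rw [← hz] at hz0 hz1
  obtain ⟨θ, hθ⟩ : ∃ θ, θ = (prependOneB B)^[n] z := ⟨_, rfl⟩
  have hθS : θ ∈ SB B := hθ ▸ iterate_prependOneB_mem_SB hB hzS n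
  have htail : cfTail θ (2 * n) = z := by
    rw [hθ]
    exact cfTail_iterate_prependOneB hB hzS n 0
  have htail1 : cfTail θ (2 * n + 1) = M := by rw [cfTail_succ, htail, hz1]
  have hdig : cfDigit θ (2 * n) = 1 := by rw [cfDigit, htail, hz0]
  have habs := abs_cfDen_sub_le (θ := θ) hM0 hm0 (by nlinarith) hMm hm n fun i hi => by
    obtain ⟨j, rfl⟩ : ∃ j, n = i + (j + 1) := ⟨n - i - 1, by omega⟩
    have h1 : cfTail θ (2 * i) = prependOneB B ((prependOneB B)^[j] z) := by
      rw [hθ, cfTail_iterate_prependOneB hB hzS, Function.iterate_succ_apply']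
    obtain ⟨-, -, h2, h3⟩ := cfTail_prependOneB hB (iterate_prependOneB_mem_SB hB hzS j).2.1
    exact ⟨by rw [← h1] at h2; exact h2, by rw [cfDigit_add, h1, h3]⟩
  obtain ⟨hi, h01, -⟩ := mem_SB_iff.1 hθS
  have hx2 : 2 * n ≤ cfDen θ (2 * n + 1) := le_cfDen_succ hi h01 (2 * n)
  have hq : cfDen θ (2 * n + 1 + 1) = cfDen θ (2 * n + 1) + cfDen θ (2 * n) := by
    rw [cfDen, hdig, one_mul]
  have hdet := cfDen_mul_cfErr hi h01 (2 * n + 1)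
  have hE := cfErr_pos hi h01 (2 * n + 1)
  have hle := le_maxGap (k := 2 * n + 1) (N := cfDen θ (2 * n + 1 + 1) + cfDen θ (2 * n + 1) - 2)
    hi h01 (by omega) (by omega) (by omega)
  refine ⟨θ, hθS, 2 * n + 1, by omega, cfDen θ (2 * n + 1 + 1) + cfDen θ (2 * n + 1) - 2,
    by omega, by omega, ?_⟩
  refine le_trans ?_ (mul_le_mul_of_nonneg_left hle (Nat.cast_nonneg _))
  rw [Nat.cast_sub (by omega), hq]
  rw [hq] at hdet
  simp only [cfErr, htail1] at hdet hE ⊢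
  push_cast at hdet ⊢
  have hx : (2 * n : ℝ) ≤ cfDen θ (2 * n + 1) := by exact_mod_cast hx2
  have hy : (0 : ℝ) ≤ cfDen θ (2 * n) := Nat.cast_nonneg _
  have hn' : (1 : ℝ) ≤ n := by exact_mod_cast hn
  generalize (cfDen θ (2 * n + 1) : ℝ) = x at *
  generalize (cfDen θ (2 * n) : ℝ) = y at *
  generalize cfErr θ (2 * n) * cfTail θ (2 * n) = e at *
  refine (sub_ten_div_le_mul_of_det hM0 hM1 hm habs (by linarith) (by linarith) hy hE.le
    (by linarith)).trans_eq (by ring)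

end Extremal

lemma irrational_sqrt_sq_add {B : ℕ} (hB : 1 ≤ B) : Irrational √((B : ℝ) ^ 2 + 4 * B) := by
  have h : ((B : ℝ) ^ 2 + 4 * B) = ((B ^ 2 + 4 * B : ℕ) : ℝ) := by push_cast; ring
  rw [h, irrational_sqrt_natCast_iff]
  rintro ⟨r, hr⟩
  have h1 : B + 1 < r := by nlinarith
  have h2 : r < B + 2 := by nlinarith
  omega

/-- **Case 1 of the proof of Theorem 4.**  The supremum of `N·H(θ,N)` over `θ ∈ S_B`,
`k ≥ 1` and integers `N` with `q_k ≤ N < q_k + q_{k-1}` equals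
`1 + ((B+1)√(B²+4B) + B² - B)/(2B² + 2B + 1)`. -/
theorem sup_case1 (B : ℕ) (hB : 1 ≤ B) :
    sSup {x : ℝ | ∃ θ ∈ SB B, ∃ k : ℕ, 1 ≤ k ∧ ∃ N : ℕ,
        ((GenContFract.of θ).dens k ≤ (N : ℝ) ∧
          (N : ℝ) < (GenContFract.of θ).dens k + (GenContFract.of θ).dens (k - 1)) ∧
        x = (N : ℝ) * maxGap θ N} =
      1 + (((B : ℝ) + 1) * Real.sqrt ((B : ℝ) ^ 2 + 4 * B) + (B : ℝ) ^ 2 - B) /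
        (2 * (B : ℝ) ^ 2 + 2 * B + 1) := by
  obtain ⟨S, hS⟩ : ∃ S, S = √((B : ℝ) ^ 2 + 4 * B) := ⟨_, rfl⟩
  have hB1 : (1 : ℝ) ≤ B := by exact_mod_cast hB
  have hSsq : S ^ 2 = (B : ℝ) ^ 2 + 4 * B := by rw [hS, Real.sq_sqrt (by positivity)]
  have hS0 : 0 ≤ S := hS ▸ Real.sqrt_nonneg _
  have hSi : Irrational S := hS ▸ irrational_sqrt_sq_add hB
  rw [← hS]
  obtain ⟨M, hM⟩ : ∃ M, M = (S - B) / 2 := ⟨_, rfl⟩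
  have hMi : Irrational M := by
    rw [hM]
    exact_mod_cast (hSi.sub_natCast B).div_natCast two_ne_zero
  have hM0 : 0 < M := by rw [hM]; nlinarith
  have hM1 : M < 1 := by rw [hM]; nlinarith
  have hMeq : M ^ 2 + B * M = B := by rw [hM]; linear_combination hSsq / 4
  have hMS : M ∈ SB B := mem_SB_of_sq_add_mul hB hMi ⟨hM0, hM1⟩ hMeq
  have hm0 : 0 < M / B := by positivity
  have hMm : M = B * (M / B) := by field_simp
  have hm : 1 - M = M * (M / B) := by field_simp; linarith
  have hval : 1 + (((B : ℝ) + 1) * S + (B : ℝ) ^ 2 - B) / (2 * (B : ℝ) ^ 2 + 2 * B + 1)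
      = (1 + M) ^ 2 / (1 + M ^ 2) := by
    have hSM : S = 2 * M + B := by rw [hM]; ring
    rw [hSM, one_add_div (by positivity), div_eq_div_iff (by positivity) (by positivity)]
    linear_combination (2 * ((B : ℝ) + 1) * M - 2 * B) * hMeq
  rw [hval]
  have hmem : ∀ {θ : ℝ} {k N : ℕ}, θ ∈ SB B → 1 ≤ k →
      (((GenContFract.of θ).dens k ≤ (N : ℝ) ∧
        (N : ℝ) < (GenContFract.of θ).dens k + (GenContFract.of θ).dens (k - 1)) ↔
      (cfDen θ (k + 1) ≤ N ∧ N < cfDen θ (k + 1) + cfDen θ k)) := by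
    intro θ k N hθ hk
    rw [dens_eq_cfDen hθ.1 hθ.2.1, dens_eq_cfDen hθ.1 hθ.2.1, Nat.sub_add_cancel hk]
    norm_cast
  refine IsLUB.csSup_eq ⟨?_, fun w hw => ?_⟩ ?_
  · rintro _ ⟨θ, hθ, k, hk, N, hN, rfl⟩
    obtain ⟨h1, h2⟩ := (hmem hθ hk).1 hN
    exact mul_maxGap_le hθ hM0 hm0 hMm hm hk h1 h2
  · by_contra! hlt
    obtain ⟨n, hn⟩ := exists_nat_gt (10 / ((1 + M) ^ 2 / (1 + M ^ 2) - w))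
    have hpos : 0 < (1 + M) ^ 2 / (1 + M ^ 2) - w := by linarith
    have hn0 : (0 : ℝ) < n := lt_trans (by positivity) hn
    obtain ⟨θ, hθ, k, hk, N, h1, h2, h3⟩ :=
      exists_mul_maxGap_ge hB hMS hm0 hMm hm (n := n) (by exact_mod_cast hn0)
    have h4 := hw ⟨θ, hθ, k, hk, N, (hmem hθ hk).2 ⟨h1, h2⟩, rfl⟩
    rw [div_lt_comm₀ hpos hn0] at hn
    linarith
  · obtain ⟨θ, hθ, k, hk, N, h1, h2, -⟩ :=
      exists_mul_maxGap_ge hB hMS hm0 hMm hm (n := 1) le_rfl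
    exact ⟨_, θ, hθ, k, hk, N, (hmem hθ hk).2 ⟨h1, h2⟩, rfl⟩
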